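/- Let α and β be continuous, positive, and integrable functions on (0,∞), and suppose lim_{u→∞} β(u)/α(u) = ρ, where ρ ∈ [0,∞]. Then lim_{z→∞} (∫₀^∞ φ(z;0,u)·β(u) du)/(∫₀^∞ φ(z;0,u)·α(u) du) = ρ. -/

import Mathlib

open MeasureTheory Real Filter Set
open scoped ENNReal

/-- Normal density with mean `0` and variance `u`. -/
noncomputable def normPdf (z u : ℝ) : ℝ :=
  (Real.sqrt (2 * Real.pi * u))⁻¹ * Real.exp (-(z ^ 2) / (2 * u))

lemma normPdf_nonneg (z u : ℝ) : 0 ≤ normPdf z u := by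
  unfold normPdf; positivity

lemma measurable_normPdf (z : ℝ) : Measurable (normPdf z) := by
  unfold normPdf; fun_prop

lemma normPdf_mono {z u v : ℝ} (hu : 0 < u) (huv : u ≤ v) (hvz : v ≤ z ^ 2) :
    normPdf z u ≤ normPdf z v := by
  have hv : 0 < v := hu.trans_le huv
  have sq_eq : ∀ w : ℝ, 0 < w → normPdf z w ^ 2 = (2 * π * w)⁻¹ * exp (-(z ^ 2) / w) := by
    intro w hw
    rw [normPdf, mul_pow, inv_pow, sq_sqrt (by positivity), ← exp_nat_mul]
    congr 2
    push_cast
    field_simp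
  have hexp : v / u ≤ exp (z ^ 2 / u - z ^ 2 / v) := by
    have h1 : v / u - 1 ≤ z ^ 2 / u - z ^ 2 / v := by
      have h2 : z ^ 2 / u - z ^ 2 / v - (v / u - 1) = (z ^ 2 - v) * (v - u) / (u * v) := by
        field_simp
      have h3 : 0 ≤ (z ^ 2 - v) * (v - u) / (u * v) :=
        div_nonneg (mul_nonneg (sub_nonneg.2 hvz) (sub_nonneg.2 huv)) (by positivity)
      linarith
    linarith [add_one_le_exp (z ^ 2 / u - z ^ 2 / v)]
  refine le_of_sq_le_sq ?_ (normPdf_nonneg z v)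
  rw [sq_eq u hu, sq_eq v hv]
  have hsplit : exp (-(z ^ 2) / v) = exp (-(z ^ 2) / u) * exp (z ^ 2 / u - z ^ 2 / v) := by
    rw [← exp_add]
    congr 1
    ring
  rw [hsplit]
  calc (2 * π * u)⁻¹ * exp (-(z ^ 2) / u)
      = (2 * π * v)⁻¹ * (exp (-(z ^ 2) / u) * (v / u)) := by field_simp
    _ ≤ _ := by gcongr

lemma normPdf_le {z u : ℝ} (hz : 0 < z) (hu : 0 < u) :
    normPdf z u ≤ (√(2 * π * z ^ 2))⁻¹ := by
  have key : ∀ w : ℝ, z ^ 2 ≤ w → normPdf z w ≤ (√(2 * π * z ^ 2))⁻¹ := by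
    intro w hw
    have hw0 : 0 < w := (by positivity : 0 < z ^ 2).trans_le hw
    calc normPdf z w ≤ (√(2 * π * w))⁻¹ * 1 := by
          unfold normPdf
          gcongr
          exact exp_le_one_iff.2 (div_nonpos_of_nonpos_of_nonneg (by nlinarith) (by positivity))
      _ ≤ _ := by
          rw [mul_one]
          gcongr
  rcases le_total u (z ^ 2) with h | h
  · exact (normPdf_mono hu h le_rfl).trans (key _ le_rfl)
  · exact key u h

lemma normPdf_eq_mul_normPdf_two_mul {U : ℝ} (hU : 0 < U) (z : ℝ) :
    normPdf z U = √2 * exp (-(z ^ 2 / (4 * U))) * normPdf z (2 * U) := by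
  have h1 : √(2 * π * (2 * U)) = √2 * √(2 * π * U) := by
    rw [← sqrt_mul (by norm_num)]
    ring_nf
  have h2 : exp (-(z ^ 2) / (2 * U)) =
      exp (-(z ^ 2 / (4 * U))) * exp (-(z ^ 2) / (2 * (2 * U))) := by
    rw [← exp_add]
    congr 1
    field_simp
    ring
  have h3 : 0 < √(2 * π * U) := sqrt_pos.2 (by positivity)
  unfold normPdf
  rw [h1, h2]
  field_simp

lemma integrableOn_normPdf_mul {f : ℝ → ℝ} (hf : IntegrableOn f (Ioi 0)) {z : ℝ} (hz : 0 < z) :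
    IntegrableOn (fun u => normPdf z u * f u) (Ioi 0) := by
  refine Integrable.bdd_mul (c := (√(2 * π * z ^ 2))⁻¹) hf
    (measurable_normPdf z).aestronglyMeasurable ?_
  filter_upwards [ae_restrict_mem measurableSet_Ioi] with u hu
  rw [norm_of_nonneg (normPdf_nonneg z u)]
  exact normPdf_le hz hu

lemma setIntegral_pos_of_pos {f : ℝ → ℝ} {s : Set ℝ} (hs : MeasurableSet s)
    (hs0 : volume s ≠ 0) (hf : IntegrableOn f s) (hpos : ∀ u ∈ s, 0 < f u) :
    0 < ∫ u in s, f u := by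
  rw [setIntegral_pos_iff_support_of_nonneg_ae
    (by filter_upwards [ae_restrict_mem hs] with u hu using (hpos u hu).le) hf]
  rw [inter_eq_right.2 (show s ⊆ Function.support f from fun u hu => (hpos u hu).ne')]
  exact pos_iff_ne_zero.2 hs0

lemma integral_normPdf_mul_pos {f : ℝ → ℝ} (hf : IntegrableOn f (Ioi 0))
    (hpos : ∀ u ∈ Ioi (0 : ℝ), 0 < f u) {z : ℝ} (hz : 0 < z) :
    0 < ∫ u in Ioi (0 : ℝ), normPdf z u * f u := by
  refine setIntegral_pos_of_pos measurableSet_Ioi (by simp) (integrableOn_normPdf_mul hf hz) ?_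
  intro u (hu : 0 < u)
  have := hpos u hu
  unfold normPdf
  positivity

lemma eventually_integral_normPdf_mul_le {f g : ℝ → ℝ}
    (hf : IntegrableOn f (Ioi 0)) (hg : IntegrableOn g (Ioi 0))
    (hfpos : ∀ u ∈ Ioi (0 : ℝ), 0 < f u) (hgpos : ∀ u ∈ Ioi (0 : ℝ), 0 < g u)
    {c d : ℝ} (hc : 0 ≤ c) (hcd : c < d) (hfg : ∀ᶠ u in atTop, f u ≤ c * g u) :
    ∀ᶠ z in atTop, ∫ u in Ioi (0 : ℝ), normPdf z u * f u ≤
      d * ∫ u in Ioi (0 : ℝ), normPdf z u * g u := by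
  obtain ⟨U, hU, hfgU⟩ : ∃ U : ℝ, 0 < U ∧ ∀ u, U ≤ u → f u ≤ c * g u := by
    obtain ⟨U, h⟩ := eventually_atTop.1 hfg
    exact ⟨max U 1, by positivity, fun u hu => h u ((le_max_left _ _).trans hu)⟩
  have hIoc : Ioc 0 U ⊆ Ioi (0 : ℝ) := fun u hu => hu.1
  have hIoi : Ioi U ⊆ Ioi (0 : ℝ) := Ioi_subset_Ioi hU.le
  have hIcc : Icc (2 * U) (3 * U) ⊆ Ioi (0 : ℝ) := fun u hu => lt_of_lt_of_le (by positivity) hu.1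
  set A := ∫ u in Icc (2 * U) (3 * U), g u with hA_def
  set B := ∫ u in Ioc 0 U, f u with hB_def
  have hA : 0 < A := by
    refine setIntegral_pos_of_pos measurableSet_Icc ?_ (hg.mono_set hIcc) fun u hu =>
      hgpos u (hIcc hu)
    rw [Real.volume_Icc]
    simp only [ne_eq, ENNReal.ofReal_eq_zero, not_le]
    linarith
  have hlim : Tendsto (fun z : ℝ => √2 * exp (-(z ^ 2 / (4 * U))) * B) atTop (nhds 0) := by
    have h1 : Tendsto (fun z : ℝ => z ^ 2 / (4 * U)) atTop atTop :=
      (tendsto_pow_atTop two_ne_zero).atTop_div_const (by positivity)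
    simpa using ((tendsto_exp_neg_atTop_nhds_zero.comp h1).const_mul (√2)).mul_const B
  have hε : 0 < (d - c) * A := mul_pos (sub_pos.2 hcd) hA
  filter_upwards [hlim.eventually_lt_const hε, eventually_gt_atTop 0,
    (tendsto_pow_atTop (α := ℝ) two_ne_zero).eventually_ge_atTop (3 * U)] with z hzε hz hzU
  have hfi := integrableOn_normPdf_mul hf hz
  have hgi := integrableOn_normPdf_mul hg hz
  have hg_nonneg : 0 ≤ᵐ[volume.restrict (Ioi (0 : ℝ))] fun u => normPdf z u * g u := by
    filter_upwards [ae_restrict_mem measurableSet_Ioi] with u hu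
    exact mul_nonneg (normPdf_nonneg z u) (hgpos u hu).le
  have hnear : ∫ u in Ioc 0 U, normPdf z u * f u ≤ normPdf z U * B := by
    rw [hB_def, ← integral_const_mul]
    refine setIntegral_mono_on (hfi.mono_set hIoc) ((hf.mono_set hIoc).const_mul _)
      measurableSet_Ioc fun u hu => ?_
    exact mul_le_mul_of_nonneg_right (normPdf_mono hu.1 hu.2 (by linarith)) (hfpos u hu.1).le
  have hfar : ∫ u in Ioi U, normPdf z u * f u ≤
      c * ∫ u in Ioi (0 : ℝ), normPdf z u * g u := by
    calc ∫ u in Ioi U, normPdf z u * f u ≤ ∫ u in Ioi U, c * (normPdf z u * g u) := by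
          refine setIntegral_mono_on (hfi.mono_set hIoi) ((hgi.mono_set hIoi).const_mul _)
            measurableSet_Ioi fun u hu => ?_
          rw [mul_left_comm]
          exact mul_le_mul_of_nonneg_left (hfgU u (le_of_lt hu)) (normPdf_nonneg z u)
      _ = c * ∫ u in Ioi U, normPdf z u * g u := integral_const_mul _ _
      _ ≤ _ := mul_le_mul_of_nonneg_left
          (setIntegral_mono_set hgi hg_nonneg hIoi.eventuallyLE) hc
  have hlower : normPdf z (2 * U) * A ≤ ∫ u in Ioi (0 : ℝ), normPdf z u * g u := by
    calc normPdf z (2 * U) * A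
        ≤ ∫ u in Icc (2 * U) (3 * U), normPdf z u * g u := by
          rw [hA_def, ← integral_const_mul]
          refine setIntegral_mono_on ((hg.mono_set hIcc).const_mul _) (hgi.mono_set hIcc)
            measurableSet_Icc fun u hu => ?_
          exact mul_le_mul_of_nonneg_right
            (normPdf_mono (by positivity) hu.1 (hu.2.trans hzU)) (hgpos u (hIcc hu)).le
      _ ≤ _ := setIntegral_mono_set hgi hg_nonneg hIcc.eventuallyLE
  have hsmall : normPdf z U * B ≤ (d - c) * (normPdf z (2 * U) * A) := by
    rw [normPdf_eq_mul_normPdf_two_mul hU]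
    nlinarith [mul_le_mul_of_nonneg_left hzε.le (normPdf_nonneg z (2 * U))]
  have hsplit : ∫ u in Ioi (0 : ℝ), normPdf z u * f u =
      (∫ u in Ioc 0 U, normPdf z u * f u) + ∫ u in Ioi U, normPdf z u * f u := by
    rw [← Ioc_union_Ioi_eq_Ioi hU.le]
    exact setIntegral_union (Ioc_disjoint_Ioi le_rfl) measurableSet_Ioi
      (hfi.mono_set hIoc) (hfi.mono_set hIoi)
  have := mul_le_mul_of_nonneg_left hlower (sub_pos.2 hcd).le
  rw [hsplit]
  linarith

/-- If `α, β` are continuous, positive, integrable functions on `(0,∞)` and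
`β(u)/α(u) → ρ ∈ [0,∞]` as `u → ∞`, then
`(∫₀^∞ φ(z;0,u) β(u) du)/(∫₀^∞ φ(z;0,u) α(u) du) → ρ` as `z → ∞`. -/
theorem mixture_ratio_tendsto (α β : ℝ → ℝ) (ρ : ℝ≥0∞)
    (hαc : ContinuousOn α (Set.Ioi 0)) (hβc : ContinuousOn β (Set.Ioi 0))
    (hαpos : ∀ u ∈ Set.Ioi (0:ℝ), 0 < α u) (hβpos : ∀ u ∈ Set.Ioi (0:ℝ), 0 < β u)
    (hαint : IntegrableOn α (Set.Ioi 0)) (hβint : IntegrableOn β (Set.Ioi 0))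
    (hlim : Filter.Tendsto (fun u : ℝ => ENNReal.ofReal (β u / α u)) Filter.atTop (nhds ρ)) :
    Filter.Tendsto
      (fun z : ℝ => ENNReal.ofReal
        ((∫ u in Set.Ioi (0:ℝ), normPdf z u * β u) /
          (∫ u in Set.Ioi (0:ℝ), normPdf z u * α u)))
      Filter.atTop (nhds ρ) := by
  refine tendsto_order.2 ⟨fun a ha => ?_, fun a ha => ?_⟩
  · obtain ⟨c, hac, hcρ⟩ := ENNReal.lt_iff_exists_nnreal_btwn.1 ha
    obtain ⟨d, hcd, hdρ⟩ := ENNReal.lt_iff_exists_nnreal_btwn.1 hcρ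
    have hc0 : (0 : ℝ) < c := by exact_mod_cast pos_of_gt hac
    have hcd' : (c : ℝ) < d := by exact_mod_cast hcd
    have hd0 : (0 : ℝ) < d := hc0.trans hcd'
    have hαβ : ∀ᶠ u in atTop, α u ≤ (d : ℝ)⁻¹ * β u := by
      filter_upwards [hlim.eventually_const_lt hdρ, eventually_gt_atTop 0] with u hu hu0
      rw [← ENNReal.ofReal_coe_nnreal, ENNReal.ofReal_lt_ofReal_iff_of_nonneg hd0.le,
        lt_div_iff₀ (hαpos u hu0)] at hu
      rw [← div_eq_inv_mul, le_div_iff₀ hd0]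
      linarith
    filter_upwards [eventually_integral_normPdf_mul_le hαint hβint hαpos hβpos
      (inv_nonneg.2 hd0.le) (inv_strictAnti₀ hc0 hcd') hαβ, eventually_gt_atTop 0] with z hz hz0
    refine hac.trans_le ?_
    rw [← ENNReal.ofReal_coe_nnreal]
    refine ENNReal.ofReal_le_ofReal ?_
    rw [le_div_iff₀ (integral_normPdf_mul_pos hαint hαpos hz0)]
    rw [← div_eq_inv_mul, le_div_iff₀ hc0] at hz
    linarith
  · obtain ⟨c, hρc, hca⟩ := ENNReal.lt_iff_exists_nnreal_btwn.1 ha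
    obtain ⟨d, hcd, hda⟩ := ENNReal.lt_iff_exists_nnreal_btwn.1 hca
    have hcd' : (c : ℝ) < d := by exact_mod_cast hcd
    have hβα : ∀ᶠ u in atTop, β u ≤ c * α u := by
      filter_upwards [hlim.eventually_lt_const hρc, eventually_gt_atTop 0] with u hu hu0
      have h := (ENNReal.ofReal_le_iff_le_toReal ENNReal.coe_ne_top).1 hu.le
      rwa [ENNReal.coe_toReal, div_le_iff₀ (hαpos u hu0)] at h
    filter_upwards [eventually_integral_normPdf_mul_le hβint hαint hβpos hαpos
      c.coe_nonneg hcd' hβα, eventually_gt_atTop 0] with z hz hz0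
    refine lt_of_le_of_lt ?_ hda
    rw [← ENNReal.ofReal_coe_nnreal]
    refine ENNReal.ofReal_le_ofReal ?_
    rwa [div_le_iff₀ (integral_normPdf_mul_pos hαint hαpos hz0)]
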